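/- Let n ≥ 1 and let S_1, S_2, …, S_n be finite sets, and let k ≥ l be positive integers such that |S_i| ≥ k for all i and |S_i ∩ S_j| ≤ l for all i ≠ j. Then |S_1 ∪ S_2 ∪ ⋯ ∪ S_n| ≥ n·k²/(k + n·l). -/

import Mathlib

/-- Cauchy-Schwarz for a family of subsets of `U`: the square of the sum of the sizes is at most
`#U` times the sum of the sizes of all pairwise intersections. -/
theorem sq_sum_card_le_card_mul_sum_card_inter {ι α : Type*} [DecidableEq α] (I : Finset ι)
    (T : ι → Finset α) (U : Finset α) (hT : ∀ i ∈ I, T i ⊆ U) :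
    (∑ i ∈ I, (T i).card) ^ 2 ≤ U.card * ∑ i ∈ I, ∑ j ∈ I, (T i ∩ T j).card := by
  have hsum : ∑ i ∈ I, (T i).card = ∑ x ∈ U, ∑ i ∈ I, if x ∈ T i then 1 else 0 := by
    rw [Finset.sum_comm]
    refine Finset.sum_congr rfl fun i hi => ?_
    rw [← Finset.card_filter, Finset.filter_mem_eq_inter, Finset.inter_eq_right.2 (hT i hi)]
  have hsq : ∑ x ∈ U, (∑ i ∈ I, if x ∈ T i then 1 else 0) ^ 2 =
      ∑ i ∈ I, ∑ j ∈ I, (T i ∩ T j).card := by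
    simp_rw [sq, Finset.sum_mul_sum]
    rw [Finset.sum_comm]
    refine Finset.sum_congr rfl fun i hi => ?_
    rw [Finset.sum_comm]
    refine Finset.sum_congr rfl fun j _ => ?_
    simp_rw [ite_zero_mul_ite_zero, mul_one, ← Finset.mem_inter]
    rw [← Finset.card_filter, Finset.filter_mem_eq_inter,
      Finset.inter_eq_right.2 (Finset.inter_subset_left.trans (hT i hi))]
  rw [hsum, ← hsq]
  exact sq_sum_le_card_mul_sum_sq

/-- Lower bound for the size of a union of large sets with small pairwise
intersections. -/
theorem union_lower_bound {α : Type*} [DecidableEq α] (n k l : ℕ) (hn : 1 ≤ n)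
    (hl : 0 < l) (hkl : l ≤ k) (S : Fin n → Finset α)
    (hsize : ∀ i, k ≤ (S i).card)
    (hinter : ∀ i j, i ≠ j → ((S i) ∩ (S j)).card ≤ l) :
    ((n : ℝ) * (k : ℝ) ^ 2) / ((k : ℝ) + (n : ℝ) * (l : ℝ))
      ≤ ((Finset.univ.biUnion S).card : ℝ) := by
  choose T hTS hTk using fun i => Finset.exists_subset_card_eq (hsize i)
  have hcs := sq_sum_card_le_card_mul_sum_card_inter Finset.univ T (Finset.univ.biUnion S)
    fun i hi => (hTS i).trans (Finset.subset_biUnion_of_mem S hi)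
  have hpairs : ∑ i, ∑ j, (T i ∩ T j).card ≤ n * (k + n * l) := by
    have hrow (i : Fin n) : ∑ j, (T i ∩ T j).card ≤ k + n * l := by
      calc ∑ j, (T i ∩ T j).card ≤ ∑ j, ((if i = j then k else 0) + l) := by
            refine Finset.sum_le_sum fun j _ => ?_
            split_ifs with hij
            · subst hij
              simp [hTk]
            · simpa using (Finset.card_le_card
                (Finset.inter_subset_inter (hTS i) (hTS j))).trans (hinter i j hij)
        _ = k + n * l := by simp [Finset.sum_add_distrib]
    simpa using Finset.sum_le_sum fun i (_ : i ∈ Finset.univ) => hrow i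
  have hnat : n * k ^ 2 ≤ (Finset.univ.biUnion S).card * (k + n * l) := by
    refine le_of_mul_le_mul_left ?_ hn
    calc n * (n * k ^ 2) = (∑ i, (T i).card) ^ 2 := by simp [hTk]; ring
      _ ≤ (Finset.univ.biUnion S).card * (n * (k + n * l)) :=
          hcs.trans (Nat.mul_le_mul_left _ hpairs)
      _ = n * ((Finset.univ.biUnion S).card * (k + n * l)) := by ring
  have hk : 0 < k := hl.trans_le hkl
  rw [div_le_iff₀ (by positivity)]
  exact_mod_cast hnat
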